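/- Entropy rate bounds (Theorem 3.6): in the non-overlapping case f_1(p_0) < f_0(p_1), setting r(x) = −( r_0(x) log r_0(x) + r_1(x) log r_1(x) ) and H(Z) = ∫ r(x) dQ(x), for every n ≥ 1 one has ∑_{(i_1,…,i_n)∈{0,1}^n} r^m_{i_1⋯i_n} · p_{i_1⋯i_n} ≤ H(Z) ≤ ∑_{(i_1,…,i_n)∈{0,1}^n} r^M_{i_1⋯i_n} · p_{i_1⋯i_n}, where r^m_{i_1⋯i_n} = min_{x ∈ I_{i_1⋯i_n}} r(x) and r^M_{i_1⋯i_n} = max_{x ∈ I_{i_1⋯i_n}} r(x). -/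

import Mathlib

open MeasureTheory

/-- `f_0(x) = ((1−ε)/ε)·(π_00 x + π_10)/(π_01 x + π_11)`. -/
noncomputable def f₀ (π00 π01 π10 π11 ε : ℝ) (x : ℝ) : ℝ :=
  ((1 - ε) / ε) * ((π00 * x + π10) / (π01 * x + π11))

/-- `f_1(x) = (ε/(1−ε))·(π_00 x + π_10)/(π_01 x + π_11)`. -/
noncomputable def f₁ (π00 π01 π10 π11 ε : ℝ) (x : ℝ) : ℝ :=
  (ε / (1 - ε)) * ((π00 * x + π10) / (π01 * x + π11))

/-- `r_0(x) = (((1−ε)π_00 + επ_01)x + ((1−ε)π_10 + επ_11))/(x+1)`. -/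
noncomputable def r₀ (π00 π01 π10 π11 ε : ℝ) (x : ℝ) : ℝ :=
  (((1 - ε) * π00 + ε * π01) * x + ((1 - ε) * π10 + ε * π11)) / (x + 1)

/-- `r_1(x) = ((επ_00 + (1−ε)π_01)x + (επ_10 + (1−ε)π_11))/(x+1)`. -/
noncomputable def r₁ (π00 π01 π10 π11 ε : ℝ) (x : ℝ) : ℝ :=
  ((ε * π00 + (1 - ε) * π01) * x + (ε * π10 + (1 - ε) * π11)) / (x + 1)

/-- `f_b` for a binary symbol `b`. -/
noncomputable def fb (π00 π01 π10 π11 ε : ℝ) (b : Bool) : ℝ → ℝ :=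
  if b then f₁ π00 π01 π10 π11 ε else f₀ π00 π01 π10 π11 ε

/-- The support of a measure on `ℝ`: the set of points all of whose open neighborhoods
have positive measure (the smallest closed set of full measure). -/
def measSupp (Q : Measure ℝ) : Set ℝ :=
  {x : ℝ | ∀ U : Set ℝ, IsOpen U → x ∈ U → 0 < Q U}

/-- Blackwell's invariance equation
`Q(E) = ∫_{f_0^{−1}(E)} r_0 dQ + ∫_{f_1^{−1}(E)} r_1 dQ` for Borel `E ⊆ (0,∞)`. -/
def BlackwellInvariant (π00 π01 π10 π11 ε : ℝ) (Q : Measure ℝ) : Prop :=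
  ∀ E : Set ℝ, MeasurableSet E → E ⊆ Set.Ioi (0 : ℝ) →
    Q E = (∫⁻ x in f₀ π00 π01 π10 π11 ε ⁻¹' E, ENNReal.ofReal (r₀ π00 π01 π10 π11 ε x) ∂Q)
      + ∫⁻ x in f₁ π00 π01 π10 π11 ε ⁻¹' E, ENNReal.ofReal (r₁ π00 π01 π10 π11 ε x) ∂Q


/-- The pair `(a_n, b_n)` associated with a binary word, with
`a_k = p_E(i_k)(π_00 a_{k−1} + π_10 b_{k−1})`,
`b_k = p_E(1−i_k)(π_01 a_{k−1} + π_11 b_{k−1})`,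
starting from the stationary distribution. (`false` codes `0` and `true` codes `1`,
so `p_E(false) = 1−ε` and `p_E(true) = ε`.) -/
noncomputable def wordPQ (π00 π01 π10 π11 ε : ℝ) (w : List Bool) : ℝ × ℝ :=
  w.foldl
    (fun ab i =>
      ((if i then ε else 1 - ε) * (π00 * ab.1 + π10 * ab.2),
       (if i then 1 - ε else ε) * (π01 * ab.1 + π11 * ab.2)))
    (π10 / (π01 + π10), π01 / (π01 + π10))

/-- The probability `p_{i_1⋯i_n} = a_n + b_n` of the output word `(i_1,…,i_n)`. -/
noncomputable def wordP (π00 π01 π10 π11 ε : ℝ) (w : List Bool) : ℝ :=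
  (wordPQ π00 π01 π10 π11 ε w).1 + (wordPQ π00 π01 π10 π11 ε w).2

/-- The interval `I_{i_1⋯i_n} = f_{i_n}∘f_{i_{n−1}}∘⋯∘f_{i_1}(I)`. -/
noncomputable def wordInterval (π00 π01 π10 π11 ε p₀ p₁ : ℝ) (w : List Bool) : Set ℝ :=
  w.foldl (fun S i => fb π00 π01 π10 π11 ε i '' S) (Set.Icc p₁ p₀)


/-- `r(x) = −( r_0(x) log r_0(x) + r_1(x) log r_1(x) )`. -/
noncomputable def rEnt (π00 π01 π10 π11 ε : ℝ) (x : ℝ) : ℝ :=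
  -(r₀ π00 π01 π10 π11 ε x * Real.log (r₀ π00 π01 π10 π11 ε x) +
    r₁ π00 π01 π10 π11 ε x * Real.log (r₁ π00 π01 π10 π11 ε x))

structure Hyp (π00 π01 π10 π11 ε : ℝ) : Prop where
  h00 : 0 < π00
  h01 : 0 < π01
  h10 : 0 < π10
  h11 : 0 < π11
  row0 : π00 + π01 = 1
  row1 : π10 + π11 = 1
  det : 0 < π00 * π11 - π01 * π10
  e0 : 0 < ε
  e1 : ε < 1 / 2

noncomputable def rb (π00 π01 π10 π11 ε : ℝ) (b : Bool) : ℝ → ℝ :=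
  if b then r₁ π00 π01 π10 π11 ε else r₀ π00 π01 π10 π11 ε

noncomputable def cA (ε : ℝ) (i : Bool) : ℝ := if i then ε else 1 - ε
noncomputable def cB (ε : ℝ) (i : Bool) : ℝ := if i then 1 - ε else ε

noncomputable def coef (π00 π01 π10 π11 ε : ℝ) : List Bool → ℝ × ℝ
  | [] => (1, 1)
  | i :: w =>
    let p := coef π00 π01 π10 π11 ε w
    (p.1 * cA ε i * π00 + p.2 * cB ε i * π01, p.1 * cA ε i * π10 + p.2 * cB ε i * π11)

noncomputable def Rw (π00 π01 π10 π11 ε : ℝ) (w : List Bool) (x : ℝ) : ℝ :=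
  (coef π00 π01 π10 π11 ε w).1 * (x / (x + 1)) + (coef π00 π01 π10 π11 ε w).2 * (1 / (x + 1))

noncomputable def Fw (π00 π01 π10 π11 ε : ℝ) (w : List Bool) (x : ℝ) : ℝ :=
  w.foldl (fun y i => fb π00 π01 π10 π11 ε i y) x

section
variable {π00 π01 π10 π11 ε : ℝ}

lemma cA_pos (H : Hyp π00 π01 π10 π11 ε) (i : Bool) : 0 < cA ε i := by
  have := H.e0; have := H.e1
  cases i <;> simp [cA] <;> linarith

lemma cB_pos (H : Hyp π00 π01 π10 π11 ε) (i : Bool) : 0 < cB ε i := by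
  have := H.e0; have := H.e1
  cases i <;> simp [cB] <;> linarith

lemma fb_eq (i : Bool) (x : ℝ) : fb π00 π01 π10 π11 ε i x =
    (cA ε i * (π00 * x + π10)) / (cB ε i * (π01 * x + π11)) := by
  cases i <;> simp [fb, cA, cB, f₀, f₁, mul_div_mul_comm]

lemma rb_eq (i : Bool) (x : ℝ) : rb π00 π01 π10 π11 ε i x =
    (cA ε i * (π00 * x + π10) + cB ε i * (π01 * x + π11)) / (x + 1) := by
  cases i <;> simp [rb, cA, cB, r₀, r₁] <;> ring

lemma numA_pos (H : Hyp π00 π01 π10 π11 ε) (i : Bool) {x : ℝ} (hx : 0 < x) :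
    0 < cA ε i * (π00 * x + π10) := by
  have := cA_pos H i; have := H.h00; have := H.h10; positivity

lemma numB_pos (H : Hyp π00 π01 π10 π11 ε) (i : Bool) {x : ℝ} (hx : 0 < x) :
    0 < cB ε i * (π01 * x + π11) := by
  have := cB_pos H i; have := H.h01; have := H.h11; positivity

lemma fb_pos (H : Hyp π00 π01 π10 π11 ε) (i : Bool) {x : ℝ} (hx : 0 < x) :
    0 < fb π00 π01 π10 π11 ε i x := by
  rw [fb_eq]; exact div_pos (numA_pos H i hx) (numB_pos H i hx)

lemma rb_pos (H : Hyp π00 π01 π10 π11 ε) (i : Bool) {x : ℝ} (hx : 0 < x) :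
    0 < rb π00 π01 π10 π11 ε i x := by
  rw [rb_eq]; exact div_pos (add_pos (numA_pos H i hx) (numB_pos H i hx)) (by linarith)

lemma rb_sum (H : Hyp π00 π01 π10 π11 ε) {x : ℝ} (hx : 0 < x) :
    rb π00 π01 π10 π11 ε false x + rb π00 π01 π10 π11 ε true x = 1 := by
  rw [rb_eq, rb_eq, ← add_div, div_eq_one_iff_eq (by linarith)]
  simp [cA, cB]
  linear_combination x * H.row0 + H.row1

lemma rb_le (H : Hyp π00 π01 π10 π11 ε) (i : Bool) {x : ℝ} (hx : 0 < x) :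
    rb π00 π01 π10 π11 ε i x ≤ 1 := by
  have := rb_sum H hx
  have h0 := rb_pos H false hx
  have h1 := rb_pos H true hx
  cases i <;> linarith

lemma meas_fb (i : Bool) : Measurable (fb π00 π01 π10 π11 ε i) := by
  rw [show fb π00 π01 π10 π11 ε i = fun x => _ from funext (fb_eq i)]
  fun_prop

lemma meas_rb (i : Bool) : Measurable (rb π00 π01 π10 π11 ε i) := by
  rw [show rb π00 π01 π10 π11 ε i = fun x => _ from funext (rb_eq i)]
  fun_prop

lemma coef_nonneg (H : Hyp π00 π01 π10 π11 ε) (w : List Bool) :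
    0 ≤ (coef π00 π01 π10 π11 ε w).1 ∧ 0 ≤ (coef π00 π01 π10 π11 ε w).2 := by
  induction w with
  | nil => simp [coef]
  | cons i w ih =>
    obtain ⟨h1, h2⟩ := ih
    have := cA_pos H i; have := cB_pos H i
    have := H.h00; have := H.h01; have := H.h10; have := H.h11
    simp only [coef]
    constructor <;> positivity

lemma wordP_eq (w : List Bool) : wordP π00 π01 π10 π11 ε w =
    (coef π00 π01 π10 π11 ε w).1 * (π10 / (π01 + π10)) +
    (coef π00 π01 π10 π11 ε w).2 * (π01 / (π01 + π10)) := by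
  unfold wordP wordPQ
  generalize π10 / (π01 + π10) = u
  generalize π01 / (π01 + π10) = v
  induction w generalizing u v with
  | nil => simp [coef]
  | cons i w ih =>
    rw [List.foldl_cons, ih]
    simp only [coef, cA, cB]
    ring

lemma Rw_cons (H : Hyp π00 π01 π10 π11 ε) (i : Bool) (w : List Bool) {x : ℝ} (hx : 0 < x) :
    Rw π00 π01 π10 π11 ε (i :: w) x =
      rb π00 π01 π10 π11 ε i x * Rw π00 π01 π10 π11 ε w (fb π00 π01 π10 π11 ε i x) := by
  have hA := numA_pos H i hx
  have hB := numB_pos H i hx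
  unfold Rw
  rw [rb_eq, fb_eq]
  have e1 : (coef π00 π01 π10 π11 ε (i :: w)).1 * (x / (x + 1)) +
      (coef π00 π01 π10 π11 ε (i :: w)).2 * (1 / (x + 1)) =
      ((coef π00 π01 π10 π11 ε w).1 * (cA ε i * (π00 * x + π10)) +
       (coef π00 π01 π10 π11 ε w).2 * (cB ε i * (π01 * x + π11))) / (x + 1) := by
    simp only [coef]; ring
  rw [e1]
  generalize cA ε i * (π00 * x + π10) = A at *
  generalize cB ε i * (π01 * x + π11) = B at *
  have : A + B ≠ 0 := by positivity
  have : x + 1 ≠ 0 := by positivity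
  field_simp

lemma Fw_pos (H : Hyp π00 π01 π10 π11 ε) (w : List Bool) {x : ℝ} (hx : 0 < x) :
    0 < Fw π00 π01 π10 π11 ε w x := by
  unfold Fw
  induction w generalizing x with
  | nil => simpa
  | cons i w ih => rw [List.foldl_cons]; exact ih (fb_pos H i hx)

lemma meas_Fw (w : List Bool) : Measurable (Fw π00 π01 π10 π11 ε w) := by
  induction w with
  | nil => exact measurable_id
  | cons i w ih => exact ih.comp (meas_fb i)

lemma meas_Rw (w : List Bool) : Measurable (Rw π00 π01 π10 π11 ε w) := by
  unfold Rw; fun_prop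

lemma mem_wordInterval (w : List Bool) (S : Set ℝ) {y : ℝ} :
    y ∈ w.foldl (fun S i => fb π00 π01 π10 π11 ε i '' S) S ↔
      ∃ x ∈ S, Fw π00 π01 π10 π11 ε w x = y := by
  unfold Fw
  induction w generalizing S with
  | nil => simp
  | cons i w ih => simp [ih]

lemma rEnt_bounds (H : Hyp π00 π01 π10 π11 ε) {x : ℝ} (hx : 0 < x) :
    0 ≤ rEnt π00 π01 π10 π11 ε x ∧ rEnt π00 π01 π10 π11 ε x ≤ 2 := by
  have key : ∀ i, 0 ≤ - (rb π00 π01 π10 π11 ε i x * Real.log (rb π00 π01 π10 π11 ε i x)) ∧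
      - (rb π00 π01 π10 π11 ε i x * Real.log (rb π00 π01 π10 π11 ε i x)) ≤ 1 := by
    intro i
    have h0 := rb_pos H i hx
    have h1 := rb_le H i hx
    generalize rb π00 π01 π10 π11 ε i x = t at *
    constructor
    · have := Real.log_nonpos h0.le h1
      nlinarith
    · have := Real.one_sub_inv_le_log_of_pos h0
      have h2 : t * (1 - t⁻¹) ≤ t * Real.log t := by gcongr
      have h3 : t * (1 - t⁻¹) = t - 1 := by field_simp
      linarith
  have k0 := key false
  have k1 := key true
  simp only [rb] at k0 k1
  unfold rEnt
  simp only [Bool.false_eq_true, if_false, if_true] at k0 k1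
  constructor <;> linarith

lemma meas_rEnt : Measurable (rEnt π00 π01 π10 π11 ε) := by
  have h0 := meas_rb (π00 := π00) (π01 := π01) (π10 := π10) (π11 := π11) (ε := ε) false
  have h1 := meas_rb (π00 := π00) (π01 := π01) (π10 := π10) (π11 := π11) (ε := ε) true
  simp only [rb, Bool.false_eq_true, if_false, if_true] at h0 h1
  unfold rEnt
  fun_prop

def Good (g : ℝ → ℝ) : Prop := Measurable g ∧ ∃ C : ℝ, ∀ x, 0 < x → |g x| ≤ C

lemma ae_pos {Q : Measure ℝ} [IsProbabilityMeasure Q] (hQ : Q (Set.Ioi 0) = 1) :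
    ∀ᵐ x ∂Q, 0 < x :=
  (prob_compl_eq_zero_iff measurableSet_Ioi).2 hQ

lemma Good.integrable {g : ℝ → ℝ} (hg : Good g) {Q : Measure ℝ} [IsProbabilityMeasure Q]
    (hQ : Q (Set.Ioi 0) = 1) : Integrable g Q := by
  obtain ⟨hm, C, hC⟩ := hg
  refine Integrable.of_bound hm.aestronglyMeasurable C ?_
  filter_upwards [ae_pos hQ] with x hx using hC x hx

lemma Good.term (H : Hyp π00 π01 π10 π11 ε) {g : ℝ → ℝ} (hg : Good g) (i : Bool) :
    Good (fun x => rb π00 π01 π10 π11 ε i x * g (fb π00 π01 π10 π11 ε i x)) := by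
  obtain ⟨hm, C, hC⟩ := hg
  refine ⟨(meas_rb i).mul (hm.comp (meas_fb i)), C, fun x hx => ?_⟩
  rw [abs_mul, abs_of_pos (rb_pos H i hx)]
  have h1 := hC _ (fb_pos H i hx)
  have h2 := rb_le H i hx
  have h3 := abs_nonneg (g (fb π00 π01 π10 π11 ε i x))
  have := rb_pos H i hx
  nlinarith

lemma Q_eq (H : Hyp π00 π01 π10 π11 ε) {Q : Measure ℝ} [IsProbabilityMeasure Q]
    (hQ : Q (Set.Ioi 0) = 1) (hI : BlackwellInvariant π00 π01 π10 π11 ε Q) :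
    Q = (Q.withDensity fun x => ENNReal.ofReal (rb π00 π01 π10 π11 ε false x)).map
          (fb π00 π01 π10 π11 ε false) +
        (Q.withDensity fun x => ENNReal.ofReal (rb π00 π01 π10 π11 ε true x)).map
          (fb π00 π01 π10 π11 ε true) := by
  ext E hE
  rw [Measure.add_apply, Measure.map_apply (meas_fb _) hE, Measure.map_apply (meas_fb _) hE,
    withDensity_apply _ (meas_fb _ hE), withDensity_apply _ (meas_fb _ hE)]
  have h1 : Q E = Q (E ∩ Set.Ioi 0) := by
    apply measure_congr
    filter_upwards [ae_pos hQ] with x hx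
    apply propext
    change x ∈ E ↔ x ∈ E ∧ 0 < x
    simp [hx]
  have h2 := hI (E ∩ Set.Ioi 0) (hE.inter measurableSet_Ioi) Set.inter_subset_right
  rw [h1, h2]
  have h3 : ∀ i, (fb π00 π01 π10 π11 ε i ⁻¹' (E ∩ Set.Ioi 0) : Set ℝ) =ᵐ[Q]
      (fb π00 π01 π10 π11 ε i ⁻¹' E : Set ℝ) := by
    intro i
    filter_upwards [ae_pos hQ] with x hx
    apply propext
    change fb π00 π01 π10 π11 ε i x ∈ E ∧ 0 < fb π00 π01 π10 π11 ε i x ↔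
      fb π00 π01 π10 π11 ε i x ∈ E
    simp [fb_pos H i hx]
  exact congrArg₂ (· + ·) (setLIntegral_congr (h3 false)) (setLIntegral_congr (h3 true))

lemma inv_int (H : Hyp π00 π01 π10 π11 ε) {Q : Measure ℝ} [IsProbabilityMeasure Q]
    (hQ : Q (Set.Ioi 0) = 1) (hI : BlackwellInvariant π00 π01 π10 π11 ε Q)
    {g : ℝ → ℝ} (hg : Good g) :
    ∫ x, g x ∂Q = ∫ x, (rb π00 π01 π10 π11 ε false x * g (fb π00 π01 π10 π11 ε false x) +
      rb π00 π01 π10 π11 ε true x * g (fb π00 π01 π10 π11 ε true x)) ∂Q := by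
  have hi := hg.integrable hQ
  rw [integral_add ((hg.term H false).integrable hQ) ((hg.term H true).integrable hQ)]
  have e := Q_eq H hQ hI
  have key : ∀ i, ∫ x, g x ∂((Q.withDensity fun x =>
      ENNReal.ofReal (rb π00 π01 π10 π11 ε i x)).map (fb π00 π01 π10 π11 ε i)) =
      ∫ x, rb π00 π01 π10 π11 ε i x * g (fb π00 π01 π10 π11 ε i x) ∂Q := by
    intro i
    rw [integral_map (meas_fb i).aemeasurable hg.1.aestronglyMeasurable,
      integral_withDensity_eq_integral_toReal_smul (meas_rb i).ennreal_ofReal (by simp)]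
    apply integral_congr_ae
    filter_upwards [ae_pos hQ] with x hx
    simp [ENNReal.toReal_ofReal (rb_pos H i hx).le]
  rw [← key, ← key]
  conv_lhs => rw [e]
  rw [e, integrable_add_measure] at hi
  exact integral_add_measure hi.1 hi.2

lemma Good.add {g h : ℝ → ℝ} (hg : Good g) (hh : Good h) : Good (fun x => g x + h x) := by
  obtain ⟨hm, C, hC⟩ := hg
  obtain ⟨hm', C', hC'⟩ := hh
  exact ⟨hm.add hm', C + C', fun x hx => (abs_add_le _ _).trans (add_le_add (hC x hx) (hC' x hx))⟩

lemma good_Rw (w : List Bool) : Good (Rw π00 π01 π10 π11 ε w) := by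
  refine ⟨meas_Rw w, |(coef π00 π01 π10 π11 ε w).1| + |(coef π00 π01 π10 π11 ε w).2|,
    fun x hx => ?_⟩
  unfold Rw
  refine (abs_add_le _ _).trans (add_le_add ?_ ?_) <;> rw [abs_mul] <;>
    refine mul_le_of_le_one_right (abs_nonneg _) ?_ <;> rw [abs_of_pos (by positivity),
      div_le_one (by positivity)] <;> linarith

lemma Rw_nonneg (H : Hyp π00 π01 π10 π11 ε) (w : List Bool) {x : ℝ} (hx : 0 < x) :
    0 ≤ Rw π00 π01 π10 π11 ε w x := by
  have := coef_nonneg H w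
  unfold Rw
  obtain ⟨h1, h2⟩ := coef_nonneg H w
  positivity

lemma good_term (H : Hyp π00 π01 π10 π11 ε) {g : ℝ → ℝ} (hg : Good g) (w : List Bool) :
    Good (fun x => Rw π00 π01 π10 π11 ε w x * g (Fw π00 π01 π10 π11 ε w x)) := by
  obtain ⟨hm, C, hC⟩ := hg
  obtain ⟨hm', C', hC'⟩ := good_Rw (π00 := π00) (π01 := π01) (π10 := π10) (π11 := π11) (ε := ε) w
  refine ⟨(meas_Rw w).mul (hm.comp (meas_Fw w)), C' * C, fun x hx => ?_⟩
  rw [abs_mul]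
  exact mul_le_mul (hC' x hx) (hC _ (Fw_pos H w hx)) (abs_nonneg _)
    ((abs_nonneg _).trans (hC' x hx))

lemma good_sum {ι : Type*} (s : Finset ι) (g : ι → ℝ → ℝ) (hg : ∀ i, Good (g i)) :
    Good (fun x => ∑ i ∈ s, g i x) := by
  classical
  induction s using Finset.induction_on with
  | empty => exact ⟨by simp, 0, by simp⟩
  | insert a s ha ih =>
    simp only [Finset.sum_insert ha]
    exact (hg a).add ih

lemma iter_int (H : Hyp π00 π01 π10 π11 ε) {Q : Measure ℝ} [IsProbabilityMeasure Q]
    (hQ : Q (Set.Ioi 0) = 1) (hI : BlackwellInvariant π00 π01 π10 π11 ε Q)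
    {g : ℝ → ℝ} (hg : Good g) (n : ℕ) :
    ∫ x, g x ∂Q = ∫ x, ∑ w : Fin n → Bool, Rw π00 π01 π10 π11 ε (List.ofFn w) x *
      g (Fw π00 π01 π10 π11 ε (List.ofFn w) x) ∂Q := by
  induction n with
  | zero =>
    apply integral_congr_ae
    filter_upwards [ae_pos hQ] with x hx
    have : x + 1 ≠ 0 := by positivity
    simp [Rw, Fw, coef]
    field_simp
  | succ n ih =>
    rw [ih, inv_int H hQ hI (good_sum _ _ fun w => good_term H hg (List.ofFn w))]
    apply integral_congr_ae
    filter_upwards [ae_pos hQ] with x hx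
    rw [← (Fin.consEquiv (fun _ : Fin (n + 1) => Bool)).sum_comp, Fintype.sum_prod_type]
    have hc : ∀ (i : Bool) (w : Fin n → Bool),
        List.ofFn ((Fin.consEquiv (fun _ : Fin (n + 1) => Bool)) (i, w)) = i :: List.ofFn w := by
      intro i w
      exact List.ofFn_cons i w
    simp only [hc, Rw_cons H _ _ hx, Fintype.sum_bool]
    rw [add_comm]
    simp only [Finset.mul_sum, mul_assoc]
    rfl

lemma good_frac : Good (fun x => x / (x + 1)) := by
  refine ⟨by fun_prop, 1, fun x hx => ?_⟩
  rw [abs_of_pos (by positivity), div_le_one (by positivity)]; linarith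

lemma mean_frac (H : Hyp π00 π01 π10 π11 ε) {Q : Measure ℝ} [IsProbabilityMeasure Q]
    (hQ : Q (Set.Ioi 0) = 1) (hI : BlackwellInvariant π00 π01 π10 π11 ε Q) :
    ∫ x, x / (x + 1) ∂Q = π10 / (π01 + π10) := by
  have h := inv_int H hQ hI good_frac
  have h2 : ∫ x, (rb π00 π01 π10 π11 ε false x *
      (fb π00 π01 π10 π11 ε false x / (fb π00 π01 π10 π11 ε false x + 1)) +
      rb π00 π01 π10 π11 ε true x *
      (fb π00 π01 π10 π11 ε true x / (fb π00 π01 π10 π11 ε true x + 1))) ∂Q =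
      ∫ x, ((π00 - π10) * (x / (x + 1)) + π10) ∂Q := by
    apply integral_congr_ae
    filter_upwards [ae_pos hQ] with x hx
    have hx1 : x + 1 ≠ 0 := by positivity
    have key : ∀ i, rb π00 π01 π10 π11 ε i x *
      (fb π00 π01 π10 π11 ε i x / (fb π00 π01 π10 π11 ε i x + 1)) =
        cA ε i * (π00 * x + π10) / (x + 1) := by
      intro i
      have hA := numA_pos H i hx
      have hB := numB_pos H i hx
      rw [rb_eq, fb_eq]
      generalize cA ε i * (π00 * x + π10) = A at *
      generalize cB ε i * (π01 * x + π11) = B at *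
      have : A + B ≠ 0 := by positivity
      field_simp
    simp only [key]
    simp only [cA]
    field_simp
    simp
    ring
  rw [h2, integral_add ((good_frac.integrable hQ).const_mul _) (integrable_const _),
    integral_const_mul] at h
  simp at h
  have := H.h01; have := H.h10
  rw [eq_div_iff (by positivity)]
  linear_combination h + (∫ x, x / (x + 1) ∂Q) * H.row0

lemma int_Rw (H : Hyp π00 π01 π10 π11 ε) {Q : Measure ℝ} [IsProbabilityMeasure Q]
    (hQ : Q (Set.Ioi 0) = 1) (hI : BlackwellInvariant π00 π01 π10 π11 ε Q) (w : List Bool) :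
    ∫ x, Rw π00 π01 π10 π11 ε w x ∂Q = wordP π00 π01 π10 π11 ε w := by
  have h1 : ∫ x, Rw π00 π01 π10 π11 ε w x ∂Q =
      ∫ x, (((coef π00 π01 π10 π11 ε w).1 - (coef π00 π01 π10 π11 ε w).2) * (x / (x + 1)) +
        (coef π00 π01 π10 π11 ε w).2) ∂Q := by
    apply integral_congr_ae
    filter_upwards [ae_pos hQ] with x hx
    have : x + 1 ≠ 0 := by positivity
    unfold Rw
    field_simp
    ring
  rw [h1, integral_add ((good_frac.integrable hQ).const_mul _) (integrable_const _),
    integral_const_mul, mean_frac H hQ hI, wordP_eq]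
  have := H.h01; have := H.h10
  have : π01 + π10 ≠ 0 := by positivity
  simp
  field_simp
  ring

lemma fb_mono (H : Hyp π00 π01 π10 π11 ε) (i : Bool) {x y : ℝ} (hx : 0 < x) (hxy : x ≤ y) :
    fb π00 π01 π10 π11 ε i x ≤ fb π00 π01 π10 π11 ε i y := by
  have hy : 0 < y := hx.trans_le hxy
  rw [fb_eq, fb_eq, div_le_div_iff₀ (numB_pos H i hx) (numB_pos H i hy)]
  have h1 : 0 < cA ε i * cB ε i := mul_pos (cA_pos H i) (cB_pos H i)
  have h2 : 0 ≤ (y - x) * (π00 * π11 - π01 * π10) := mul_nonneg (by linarith) H.det.le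
  nlinarith [mul_nonneg h1.le h2]

lemma fb_true_le_false (H : Hyp π00 π01 π10 π11 ε) {x : ℝ} (hx : 0 < x) :
    fb π00 π01 π10 π11 ε true x ≤ fb π00 π01 π10 π11 ε false x := by
  rw [fb_eq, fb_eq]
  have := H.e0; have := H.e1; have := H.h01; have := H.h10; have := H.h11; have := H.h00
  simp only [cA, cB, if_true, Bool.false_eq_true, if_false]
  have : 0 < 1 - ε := by linarith
  gcongr <;> linarith

/-- the sign of `x - f x` is the sign of `x - p`. -/
lemma fb_cmp (H : Hyp π00 π01 π10 π11 ε) (i : Bool) {p x : ℝ} (hp : 0 < p) (hx : 0 < x)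
    (hfix : fb π00 π01 π10 π11 ε i p = p) :
    ∃ k, 0 < k ∧ x - fb π00 π01 π10 π11 ε i x = k * (x - p) := by
  have hBx := numB_pos H i hx
  have hBp := numB_pos H i hp
  have hAp := numA_pos H i hp
  have h1 := cA_pos H i
  have h2 := cB_pos H i
  have := H.h01; have := H.h10; have := H.h11; have := H.h00
  rw [fb_eq, div_eq_iff hBp.ne'] at hfix
  refine ⟨(cB ε i * π01 * x + cA ε i * π10 / p) / (cB ε i * (π01 * x + π11)),
    by positivity, ?_⟩
  rw [fb_eq]
  field_simp
  linear_combination (-x) * hfix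

noncomputable def bnd (y : ℝ) : ℝ := y / (y + 1)

lemma bnd_lt {x y : ℝ} (hx : 0 < x) (hxy : x < y) : bnd x < bnd y := by
  unfold bnd
  rw [div_lt_div_iff₀ (by linarith) (by linarith)]
  nlinarith

lemma bnd_le {x y : ℝ} (hx : 0 < x) (hxy : x ≤ y) : bnd x ≤ bnd y := by
  rcases hxy.eq_or_lt with h | h
  · rw [h]
  · exact (bnd_lt hx h).le

lemma good_bnd_comp {u : ℝ → ℝ} (hu : Measurable u) (hpos : ∀ x, 0 < x → 0 < u x) :
    Good (fun x => bnd (u x)) := by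
  refine ⟨by unfold bnd; fun_prop, 1, fun x hx => ?_⟩
  have := hpos x hx
  unfold bnd
  rw [abs_of_pos (by positivity), div_le_one (by positivity)]; linarith

lemma ae_eq_of_int_le {Q : Measure ℝ} {g h : ℝ → ℝ} (hg : Integrable g Q) (hh : Integrable h Q)
    (hle : ∀ᵐ x ∂Q, g x ≤ h x) (hint : ∫ x, h x ∂Q ≤ ∫ x, g x ∂Q) : ∀ᵐ x ∂Q, g x = h x := by
  have h0 : ∫ x, (h x - g x) ∂Q = 0 := by
    have := integral_mono_ae hg hh hle
    rw [integral_sub hh hg]; linarith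
  have := (integral_eq_zero_iff_of_nonneg_ae (f := fun x => h x - g x)
    (by filter_upwards [hle] with x hx; simpa using hx) (hh.sub hg)).1 h0
  filter_upwards [this] with x hx
  simp at hx; linarith

lemma ae_le (H : Hyp π00 π01 π10 π11 ε) {Q : Measure ℝ} [IsProbabilityMeasure Q]
    (hQ : Q (Set.Ioi 0) = 1) (hI : BlackwellInvariant π00 π01 π10 π11 ε Q) {p : ℝ} (hp : 0 < p)
    (hfix : fb π00 π01 π10 π11 ε false p = p) : ∀ᵐ x ∂Q, x ≤ p := by
  have hgood : Good (fun x => bnd (max x p)) :=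
    good_bnd_comp (by fun_prop) fun x hx => lt_max_of_lt_left hx
  have hmf := meas_fb (π00 := π00) (π01 := π01) (π10 := π10) (π11 := π11) (ε := ε) false
  have hgoodf : Good (fun x => bnd (max (fb π00 π01 π10 π11 ε false x) p)) :=
    good_bnd_comp (by fun_prop) fun x hx => lt_max_of_lt_right hp
  have hle : ∀ᵐ x ∂Q, bnd (max (fb π00 π01 π10 π11 ε false x) p) ≤ bnd (max x p) := by
    filter_upwards [ae_pos hQ] with x hx
    apply bnd_le (lt_max_of_lt_right hp)
    refine max_le ?_ (le_max_right _ _)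
    rcases le_total x p with h | h
    · exact (fb_mono H false hx h).trans (hfix.le.trans (le_max_right _ _))
    · obtain ⟨k, hk, e⟩ := fb_cmp H false hp hx hfix
      refine le_trans ?_ (le_max_left _ _)
      nlinarith [mul_nonneg hk.le (sub_nonneg.2 h)]
  have hint : ∫ x, bnd (max x p) ∂Q ≤ ∫ x, bnd (max (fb π00 π01 π10 π11 ε false x) p) ∂Q := by
    rw [inv_int H hQ hI hgood]
    apply integral_mono_ae (((hgood.term H false).add (hgood.term H true)).integrable hQ)
      (hgoodf.integrable hQ)
    filter_upwards [ae_pos hQ] with x hx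
    have h1 := rb_sum H hx
    have h2 := rb_pos H true hx
    have h3 : bnd (max (fb π00 π01 π10 π11 ε true x) p) ≤
        bnd (max (fb π00 π01 π10 π11 ε false x) p) :=
      bnd_le (lt_max_of_lt_right hp) (max_le_max_right _ (fb_true_le_false H hx))
    have h4 : rb π00 π01 π10 π11 ε false x = 1 - rb π00 π01 π10 π11 ε true x := by linarith
    simp only [h4]
    nlinarith
  filter_upwards [ae_pos hQ, ae_eq_of_int_le (hgoodf.integrable hQ) (hgood.integrable hQ) hle hint]
    with x hx hxe
  by_contra! hc
  obtain ⟨k, hk, e⟩ := fb_cmp H false hp hx hfix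
  have : fb π00 π01 π10 π11 ε false x < x := by nlinarith [mul_pos hk (sub_pos.2 hc)]
  have h5 := bnd_lt (x := max (fb π00 π01 π10 π11 ε false x) p) (y := max x p)
    (lt_max_of_lt_right hp) (lt_of_lt_of_le (max_lt this hc) (le_max_left _ _))
  linarith

lemma ae_ge (H : Hyp π00 π01 π10 π11 ε) {Q : Measure ℝ} [IsProbabilityMeasure Q]
    (hQ : Q (Set.Ioi 0) = 1) (hI : BlackwellInvariant π00 π01 π10 π11 ε Q) {p : ℝ} (hp : 0 < p)
    (hfix : fb π00 π01 π10 π11 ε true p = p) : ∀ᵐ x ∂Q, p ≤ x := by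
  have hgood : Good (fun x => bnd (min x p)) :=
    good_bnd_comp (by fun_prop) fun x hx => lt_min hx hp
  have hmf := meas_fb (π00 := π00) (π01 := π01) (π10 := π10) (π11 := π11) (ε := ε) true
  have hgoodf : Good (fun x => bnd (min (fb π00 π01 π10 π11 ε true x) p)) :=
    good_bnd_comp (by fun_prop) fun x hx => lt_min (fb_pos H true hx) hp
  have hle : ∀ᵐ x ∂Q, bnd (min x p) ≤ bnd (min (fb π00 π01 π10 π11 ε true x) p) := by
    filter_upwards [ae_pos hQ] with x hx
    apply bnd_le (lt_min hx hp)
    refine le_min ?_ (min_le_right _ _)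
    rcases le_total p x with h | h
    · exact (min_le_right _ _).trans (hfix.ge.trans (fb_mono H true hp h))
    · obtain ⟨k, hk, e⟩ := fb_cmp H true hp hx hfix
      refine le_trans (min_le_left _ _) ?_
      nlinarith [mul_nonneg hk.le (sub_nonneg.2 h)]
  have hint : ∫ x, bnd (min (fb π00 π01 π10 π11 ε true x) p) ∂Q ≤ ∫ x, bnd (min x p) ∂Q := by
    rw [inv_int H hQ hI hgood]
    apply integral_mono_ae (hgoodf.integrable hQ)
      (((hgood.term H false).add (hgood.term H true)).integrable hQ)
    filter_upwards [ae_pos hQ] with x hx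
    have h1 := rb_sum H hx
    have h2 := rb_pos H false hx
    have h3 : bnd (min (fb π00 π01 π10 π11 ε true x) p) ≤
        bnd (min (fb π00 π01 π10 π11 ε false x) p) :=
      bnd_le (lt_min (fb_pos H true hx) hp) (min_le_min_right _ (fb_true_le_false H hx))
    have h4 : rb π00 π01 π10 π11 ε true x = 1 - rb π00 π01 π10 π11 ε false x := by linarith
    simp only [h4]
    nlinarith
  filter_upwards [ae_pos hQ, ae_eq_of_int_le (hgood.integrable hQ) (hgoodf.integrable hQ) hle hint]
    with x hx hxe
  by_contra! hc
  obtain ⟨k, hk, e⟩ := fb_cmp H true hp hx hfix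
  have : x < fb π00 π01 π10 π11 ε true x := by nlinarith [mul_pos hk (sub_pos.2 hc)]
  have h5 := bnd_lt (x := min x p) (y := min (fb π00 π01 π10 π11 ε true x) p)
    (lt_min hx hp) (lt_of_le_of_lt (min_le_left _ _) (lt_min this hc))
  linarith

end

/-- Theorem 3.6 (entropy rate bounds): in the non-overlapping case `f_1(p_0) < f_0(p_1)`,
`∑_w min_{I_w} r · p_w ≤ H(Z) = ∫ r dQ ≤ ∑_w max_{I_w} r · p_w` for every `n ≥ 1`. -/
theorem entropy_rate_bounds (π00 π01 π10 π11 ε : ℝ)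
    (h00 : 0 < π00) (h01 : 0 < π01) (h10 : 0 < π10) (h11 : 0 < π11)
    (hrow0 : π00 + π01 = 1) (hrow1 : π10 + π11 = 1)
    (hdet : 0 < π00 * π11 - π01 * π10)
    (hε0 : 0 < ε) (hε : ε < 1 / 2)
    (p₀ p₁ : ℝ) (hp₀ : 0 < p₀) (hp₁ : 0 < p₁)
    (hfix₀ : f₀ π00 π01 π10 π11 ε p₀ = p₀) (hfix₁ : f₁ π00 π01 π10 π11 ε p₁ = p₁)
    (huniq₀ : ∀ q : ℝ, 0 < q → f₀ π00 π01 π10 π11 ε q = q → q = p₀)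
    (huniq₁ : ∀ q : ℝ, 0 < q → f₁ π00 π01 π10 π11 ε q = q → q = p₁)
    (Q : MeasureTheory.Measure ℝ) [MeasureTheory.IsProbabilityMeasure Q]
    (hQpos : Q (Set.Ioi 0) = 1)
    (hQinv : BlackwellInvariant π00 π01 π10 π11 ε Q)
    (hnonoverlap : f₁ π00 π01 π10 π11 ε p₀ < f₀ π00 π01 π10 π11 ε p₁) :
    ∀ n : ℕ, 1 ≤ n →
      (∑ w : Fin n → Bool,
          sInf (rEnt π00 π01 π10 π11 ε '' wordInterval π00 π01 π10 π11 ε p₀ p₁ (List.ofFn w))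
            * wordP π00 π01 π10 π11 ε (List.ofFn w))
        ≤ (∫ x, rEnt π00 π01 π10 π11 ε x ∂Q) ∧
      (∫ x, rEnt π00 π01 π10 π11 ε x ∂Q)
        ≤ ∑ w : Fin n → Bool,
            sSup (rEnt π00 π01 π10 π11 ε '' wordInterval π00 π01 π10 π11 ε p₀ p₁ (List.ofFn w))
              * wordP π00 π01 π10 π11 ε (List.ofFn w) := by
  intro n _
  have H : Hyp π00 π01 π10 π11 ε := ⟨h00, h01, h10, h11, hrow0, hrow1, hdet, hε0, hε⟩
  have hup := ae_le H hQpos hQinv hp₀ hfix₀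
  have hlo := ae_ge H hQpos hQinv hp₁ hfix₁
  have hgood : Good (rEnt π00 π01 π10 π11 ε) := by
    refine ⟨meas_rEnt, 2, fun x hx => ?_⟩
    have := rEnt_bounds H hx
    rw [abs_of_nonneg this.1]; exact this.2
  have hpos : ∀ w : List Bool, ∀ y ∈ wordInterval π00 π01 π10 π11 ε p₀ p₁ w, 0 < y := by
    intro w y hy
    obtain ⟨x, hx, rfl⟩ := (mem_wordInterval w _).1 hy
    exact Fw_pos H w (hp₁.trans_le hx.1)
  have hmem : ∀ w : List Bool, ∀ᵐ x ∂Q, Fw π00 π01 π10 π11 ε w x ∈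
      wordInterval π00 π01 π10 π11 ε p₀ p₁ w := by
    intro w
    filter_upwards [hup, hlo] with x h1 h2
    exact (mem_wordInterval w _).2 ⟨x, ⟨h2, h1⟩, rfl⟩
  have hi : ∀ w : Fin n → Bool, Integrable (fun x => Rw π00 π01 π10 π11 ε (List.ofFn w) x *
      rEnt π00 π01 π10 π11 ε (Fw π00 π01 π10 π11 ε (List.ofFn w) x)) Q :=
    fun w => (good_term H hgood _).integrable hQpos
  rw [iter_int H hQpos hQinv hgood n, integral_finsetSum _ fun w _ => hi w]
  constructor
  · refine Finset.sum_le_sum fun w _ => ?_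
    rw [← int_Rw H hQpos hQinv, ← integral_const_mul]
    refine integral_mono_ae (((good_Rw _).integrable hQpos).const_mul _) (hi w) ?_
    filter_upwards [ae_pos hQpos, hmem (List.ofFn w)] with x hx hm
    rw [mul_comm]
    refine mul_le_mul_of_nonneg_left (csInf_le ⟨0, ?_⟩ ⟨_, hm, rfl⟩) (Rw_nonneg H _ hx)
    rintro _ ⟨y, hy, rfl⟩
    exact (rEnt_bounds H (hpos _ y hy)).1
  · refine Finset.sum_le_sum fun w _ => ?_
    rw [← int_Rw H hQpos hQinv, ← integral_const_mul]
    refine integral_mono_ae (hi w) (((good_Rw _).integrable hQpos).const_mul _) ?_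
    filter_upwards [ae_pos hQpos, hmem (List.ofFn w)] with x hx hm
    rw [mul_comm]
    refine mul_le_mul_of_nonneg_right (le_csSup ⟨2, ?_⟩ ⟨_, hm, rfl⟩) (Rw_nonneg H _ hx)
    rintro _ ⟨y, hy, rfl⟩
    exact (rEnt_bounds H (hpos _ y hy)).2
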